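/- arXiv:2104.02885 — 2 statements merged into one kernel-verified Lean document; each statement's English description precedes it below -/
import Mathlib

section
/- For every integer N ≥ 2, the normalized Dirichlet kernel g_N is strictly positive on [0, 2/N) and strictly decreasing on [0, 2/N]: for all real x_1, x_2 with 0 ≤ x_1 < x_2 ≤ 2/N one has g_N(x_2) < g_N(x_1), and g_N(x) > 0 for 0 ≤ x < 2/N. -/
/-- The normalized Dirichlet kernel `g_N(x) = sin (N π x / 2) / (N sin (π x / 2))`,
with the convention `g_N(0) = 1`. -/
noncomputable def dirichletKernel (N : ℕ) (x : ℝ) : ℝ :=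
  if x = 0 then 1
  else Real.sin ((N : ℝ) * Real.pi * x / 2) / ((N : ℝ) * Real.sin (Real.pi * x / 2))

open Real in
theorem dk_aux (a b : ℝ) (ha : 0 < a) (hab : a < b) (n : ℕ) (hn : 2 ≤ n) :
    (n : ℝ) * b ≤ π → sin (n * b) * sin a < sin (n * a) * sin b := by
  induction n, hn using Nat.le_induction with
  | base =>
    intro h
    push_cast at h ⊢
    have hsa : 0 < sin a := sin_pos_of_pos_of_lt_pi ha (by linarith)
    have hsb : 0 < sin b := sin_pos_of_pos_of_lt_pi (by linarith) (by linarith)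
    have hc : cos b < cos a := cos_lt_cos_of_nonneg_of_le_pi ha.le (by linarith) hab
    rw [sin_two_mul, sin_two_mul]
    nlinarith [mul_lt_mul_of_pos_left hc (mul_pos hsa hsb)]
  | succ n hn ih =>
    intro h
    push_cast at h ⊢
    have hn2 : (2 : ℝ) ≤ n := by exact_mod_cast hn
    have hb : 0 < b := by linarith
    have hnb : (n : ℝ) * b ≤ π := by nlinarith
    have h2b : 2 * b ≤ n * b := mul_le_mul_of_nonneg_right hn2 hb.le
    have hlt : (n : ℝ) * a < n * b := mul_lt_mul_of_pos_left hab (by linarith)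
    have hna : 0 < (n : ℝ) * a := mul_pos (by linarith) ha
    have hsa : 0 < sin a := sin_pos_of_pos_of_lt_pi ha (by linarith)
    have hsb : 0 < sin b := sin_pos_of_pos_of_lt_pi (by linarith) (by linarith)
    have hc : cos b < cos a := cos_lt_cos_of_nonneg_of_le_pi ha.le (by linarith) hab
    have hcn : cos (n * b) < cos (n * a) := cos_lt_cos_of_nonneg_of_le_pi hna.le hnb hlt
    have hcb : 0 ≤ cos b := cos_nonneg_of_neg_pi_div_two_le_of_le (by linarith) (by linarith)
    have hsn : 0 < sin (n * a) := sin_pos_of_pos_of_lt_pi hna (by linarith)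
    have h1 := mul_le_mul_of_nonneg_right (ih hnb).le hcb
    have h2 := mul_lt_mul_of_pos_left hc (mul_pos hsn hsb)
    have h3 := mul_lt_mul_of_pos_left hcn (mul_pos hsa hsb)
    rw [add_mul, add_mul, one_mul, one_mul, sin_add, sin_add]
    linarith

open Real in
theorem dk_aux0 (b : ℝ) (hb : 0 < b) (n : ℕ) (hn : 2 ≤ n) :
    (n : ℝ) * b ≤ π → sin (n * b) < n * sin b := by
  induction n, hn using Nat.le_induction with
  | base =>
    intro h
    push_cast at h ⊢
    have hsb : 0 < sin b := sin_pos_of_pos_of_lt_pi (by linarith) (by linarith)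
    have hc : cos b < cos 0 := cos_lt_cos_of_nonneg_of_le_pi le_rfl (by linarith) hb
    rw [cos_zero] at hc
    rw [sin_two_mul]
    nlinarith [mul_lt_mul_of_pos_left hc hsb]
  | succ n hn ih =>
    intro h
    push_cast at h ⊢
    have hn2 : (2 : ℝ) ≤ n := by exact_mod_cast hn
    have hnb : (n : ℝ) * b ≤ π := by nlinarith
    have h2b : 2 * b ≤ n * b := mul_le_mul_of_nonneg_right hn2 hb.le
    have hsb : 0 < sin b := sin_pos_of_pos_of_lt_pi (by linarith) (by linarith)
    have hc : cos b < cos 0 := cos_lt_cos_of_nonneg_of_le_pi le_rfl (by linarith) hb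
    rw [cos_zero] at hc
    have hcb : 0 ≤ cos b := cos_nonneg_of_neg_pi_div_two_le_of_le (by linarith) (by linarith)
    have h1 := mul_le_mul_of_nonneg_right (ih hnb).le hcb
    have h2 := mul_lt_mul_of_pos_left hc (mul_pos (by linarith : (0 : ℝ) < n) hsb)
    have h3 := mul_le_mul_of_nonneg_right (cos_le_one (n * b)) hsb.le
    rw [add_mul, add_mul, one_mul, one_mul, sin_add]
    linarith

/-- For every integer `N ≥ 2`, the normalized Dirichlet kernel `g_N` is
strictly decreasing on `[0, 2/N]` and strictly positive on `[0, 2/N)`. -/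
theorem dirichletKernel_mainlobe (N : ℕ) (hN : 2 ≤ N) :
    (∀ x₁ x₂ : ℝ, 0 ≤ x₁ → x₁ < x₂ → x₂ ≤ 2 / (N : ℝ) →
      dirichletKernel N x₂ < dirichletKernel N x₁) ∧
    (∀ x : ℝ, 0 ≤ x → x < 2 / (N : ℝ) → 0 < dirichletKernel N x) := by
  have hn2 : (2 : ℝ) ≤ N := by exact_mod_cast hN
  have hn0 : (0 : ℝ) < N := by linarith
  have hpi := Real.pi_pos
  have key : ∀ x : ℝ, (N : ℝ) * Real.pi * x / 2 = N * (Real.pi * x / 2) := fun x => by ring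
  have hs : ∀ x : ℝ, 0 < x → (N : ℝ) * x ≤ 2 → 0 < Real.sin (Real.pi * x / 2) := by
    intro x hx h
    have h1 : x ≤ 1 := by nlinarith
    apply Real.sin_pos_of_pos_of_lt_pi (by positivity)
    nlinarith
  refine ⟨fun x y hx hxy hy => ?_, fun x hx hx2 => ?_⟩
  · rw [le_div_iff₀ hn0, mul_comm] at hy
    have hy0 : 0 < y := by linarith
    have hb : (N : ℝ) * (Real.pi * y / 2) ≤ Real.pi := by nlinarith
    have hsy := hs y hy0 hy
    unfold dirichletKernel
    rw [if_neg hy0.ne', key, key]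
    split_ifs with h
    · rw [div_lt_one (by positivity)]
      exact dk_aux0 _ (by positivity) N hN hb
    · have hx0 : 0 < x := lt_of_le_of_ne hx (Ne.symm h)
      have hsx := hs x hx0 (by nlinarith)
      have hh := dk_aux (Real.pi * x / 2) (Real.pi * y / 2) (by positivity) (by nlinarith) N hN hb
      rw [div_lt_div_iff₀ (by positivity) (by positivity)]
      linarith [mul_lt_mul_of_pos_left hh hn0]
  · rw [lt_div_iff₀ hn0, mul_comm] at hx2
    unfold dirichletKernel
    split_ifs with h
    · exact one_pos
    · have hx0 : 0 < x := lt_of_le_of_ne hx (Ne.symm h)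
      have hsx := hs x hx0 hx2.le
      have : 0 < Real.sin ((N : ℝ) * Real.pi * x / 2) := by
        apply Real.sin_pos_of_pos_of_lt_pi (by positivity)
        nlinarith
      positivity
end

section
/- For every integer N ≥ 2 and every real x with 2/N ≤ x ≤ 2 − 2/N, the normalized Dirichlet kernel satisfies the sidelobe bound |g_N(x)| ≤ 1/(N·sin(π/N)). -/
/-- For every integer `N ≥ 2` and every real `x` with
`2/N ≤ x ≤ 2 - 2/N`, the sidelobe bound `|g_N(x)| ≤ 1 / (N sin (π / N))` holds. -/
theorem dirichletKernel_sidelobe (N : ℕ) (hN : 2 ≤ N) (x : ℝ)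
    (hx₁ : 2 / (N : ℝ) ≤ x) (hx₂ : x ≤ 2 - 2 / (N : ℝ)) :
    |dirichletKernel N x| ≤ 1 / ((N : ℝ) * Real.sin (Real.pi / (N : ℝ))) := by
  have hN' : (2 : ℝ) ≤ (N : ℝ) := by exact_mod_cast hN
  have hN0 : (0 : ℝ) < (N : ℝ) := by linarith
  have hpi := Real.pi_pos
  have hq : 0 < 2 / (N : ℝ) := by positivity
  have hx0 : x ≠ 0 := by linarith
  have ha0 : 0 < Real.pi / (N : ℝ) := by positivity
  have ha : Real.pi / (N : ℝ) = Real.pi * (2 / (N : ℝ)) / 2 := by ring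
  have ha2 : Real.pi / (N : ℝ) ≤ Real.pi / 2 := by gcongr
  have h1 : Real.pi / (N : ℝ) ≤ Real.pi * x / 2 := by
    rw [ha]; gcongr
  have h2 : Real.pi * x / 2 ≤ Real.pi - Real.pi / (N : ℝ) := by
    rw [ha]
    have := mul_le_mul_of_nonneg_left hx₂ hpi.le
    linarith
  have hs0 : 0 < Real.sin (Real.pi / (N : ℝ)) :=
    Real.sin_pos_of_pos_of_lt_pi ha0 (by linarith)
  have hs : Real.sin (Real.pi / (N : ℝ)) ≤ Real.sin (Real.pi * x / 2) := by
    rcases le_total (Real.pi * x / 2) (Real.pi / 2) with h | h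
    · exact Real.sin_le_sin_of_le_of_le_pi_div_two (by linarith) h h1
    · rw [← Real.sin_pi_sub (Real.pi * x / 2)]
      exact Real.sin_le_sin_of_le_of_le_pi_div_two (by linarith) (by linarith) (by linarith)
  have hs1 : 0 < Real.sin (Real.pi * x / 2) := lt_of_lt_of_le hs0 hs
  unfold dirichletKernel
  rw [if_neg hx0, abs_div, abs_of_pos (mul_pos hN0 hs1)]
  exact div_le_div₀ zero_le_one (Real.abs_sin_le_one _) (mul_pos hN0 hs0)
    (mul_le_mul_of_nonneg_left hs hN0.le)
end
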